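/- arXiv:math/0205087 — 6 statements merged into one kernel-verified Lean document; each statement's English description precedes it below -/
import Mathlib

section
/- For every a ∈ A, every integer i ≥ 0 and every integer j ≥ 1, the identity φ(a) · X^i · Y^j · X = p^j · φ(a) · X^{i+1} · Y^j − φ(a · (p^j·α^{i+1}(u) − α^{i−j+1}(u))) · X^i · Y^{j−1} holds in B, where α^{i−j+1} denotes an integer (possibly negative) power of the automorphism α. (Lemma 1.3(2).) -/
/-- Lemma 1.3(2) of Guccione–Guccione, "Hochschild homology of iterated skew
polynomial rings":
`φ(a) X^i Y^j X = p^j φ(a) X^{i+1} Y^j − φ(a(p^j α^{i+1}(u) − α^{i−j+1}(u))) X^i Y^{j−1}`,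
for `i ≥ 0`, `j ≥ 1`. -/
theorem stmt1 {k A B : Type*} [CommRing k] [Ring A] [Algebra k A]
    [Ring B] [Algebra k B]
    (α γ : A ≃ₐ[k] A) (hcomm : ∀ a : A, α (γ a) = γ (α a))
    (u : A) (hγu : γ u = u) (hu : ∀ a : A, u * a = γ a * u)
    (p : kˣ) (φ : A →ₐ[k] B) (X Y : B)
    (hX : ∀ a : A, X * φ a = φ (α a) * X)
    (hY : ∀ a : A, Y * φ a = φ (γ (α.symm a)) * Y)
    (hYX : Y * X = (p : k) • (X * Y) + φ u - (p : k) • φ (α u)) :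
    ∀ (a : A) (i j : ℕ), 1 ≤ j →
      φ a * X ^ i * Y ^ j * X =
        ((p : k) ^ j) • (φ a * X ^ (i + 1) * Y ^ j) -
          φ (a * (((p : k) ^ j) • ((α ^ (i + 1)) u) - (α ^ ((i : ℤ) - (j : ℤ) + 1)) u)) *
            X ^ i * Y ^ (j - 1) := by
  have hγz : ∀ n : ℕ, γ ((α ^ (-(n : ℤ))) u) = (α ^ (-(n : ℤ))) u := by
    intro n
    have hc : Commute γ α := by
      ext a
      exact (hcomm a).symm
    have h := congrArg (fun f : A ≃ₐ[k] A => f u) (hc.zpow_right (-(n : ℤ))).eq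
    simp only [AlgEquiv.mul_apply, hγu] at h
    exact h
  have hsymm : ∀ n : ℕ, α.symm ((α ^ (-(n : ℤ))) u) = (α ^ (-((n + 1 : ℕ) : ℤ))) u := by
    intro n
    rw [AlgEquiv.symm_apply_eq, ← AlgEquiv.mul_apply, ← zpow_one_add]
    congr 2
    push_cast
    ring
  have key : ∀ n : ℕ, Y ^ (n + 1) * X = ((p : k) ^ (n + 1)) • (X * Y ^ (n + 1)) -
      φ (((p : k) ^ (n + 1)) • (α u) - (α ^ (-(n : ℤ))) u) * Y ^ n := by
    intro n
    induction n with
    | zero =>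
      simp [hYX]
      abel
    | succ n ih =>
      have hb : γ (α.symm (((p : k) ^ (n + 1)) • (α u) - (α ^ (-(n : ℤ))) u)) =
          ((p : k) ^ (n + 1)) • u - (α ^ (-((n + 1 : ℕ) : ℤ))) u := by
        rw [map_sub, map_sub, hsymm, hγz]
        simp [hγu]
      rw [pow_succ' Y (n + 1), mul_assoc, ih, mul_sub, mul_smul_comm, ← mul_assoc, hYX,
        ← mul_assoc, hY, hb, mul_assoc (φ _) Y, ← pow_succ' Y n]
      simp only [map_sub, map_smul, sub_mul, add_mul, smul_mul_assoc, smul_sub, smul_add,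
        smul_smul, ← pow_succ, mul_assoc]
      abel
  have hXi : ∀ (i : ℕ) (b : A), X ^ i * φ b = φ ((α ^ i) b) * X ^ i := by
    intro i
    induction i with
    | zero => intro b; simp
    | succ i ih =>
      intro b
      rw [pow_succ, mul_assoc, hX, ← mul_assoc, ih, mul_assoc, pow_succ α, AlgEquiv.mul_apply]
  intro a i j hj
  obtain ⟨n, rfl⟩ : ∃ n, j = n + 1 := ⟨j - 1, by omega⟩
  have hai : (α ^ i) (((p : k) ^ (n + 1)) • (α u) - (α ^ (-(n : ℤ))) u) =
      ((p : k) ^ (n + 1)) • ((α ^ (i + 1)) u) - (α ^ ((i : ℤ) - ((n + 1 : ℕ) : ℤ) + 1)) u := by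
    have e : (i : ℤ) - ((n + 1 : ℕ) : ℤ) + 1 = (i : ℤ) + -(n : ℤ) := by push_cast; ring
    rw [e, zpow_add, zpow_natCast, map_sub, map_smul, pow_succ α, AlgEquiv.mul_apply,
      AlgEquiv.mul_apply]
  rw [mul_assoc _ (Y ^ _) X, key, mul_sub, ← mul_assoc, ← hai, map_mul, Nat.add_sub_cancel,
    mul_assoc (φ a) (X ^ i) (φ _), hXi, mul_smul_comm, pow_succ X]
  simp only [mul_assoc]
end

section
/- For every a ∈ A, every integer i ≥ 1 and every integer j ≥ 0, the identity Y · φ(a) · X^i · Y^j = p^i · φ(γ(α^{−1}(a))) · X^i · Y^{j+1} − φ(γ(α^{−1}(a)) · (p^i·α^i(u) − u)) · X^{i−1} · Y^j holds in B. (Lemma 1.3(3).) -/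
/-- Lemma 1.3(3) of Guccione–Guccione, "Hochschild homology of iterated skew
polynomial rings":
`Y φ(a) X^i Y^j = p^i φ(γ(α^{-1}(a))) X^i Y^{j+1} − φ(γ(α^{-1}(a))(p^i α^i(u) − u)) X^{i−1} Y^j`,
for `i ≥ 1`, `j ≥ 0`. -/
theorem stmt2 {k A B : Type*} [CommRing k] [Ring A] [Algebra k A]
    [Ring B] [Algebra k B]
    (α γ : A ≃ₐ[k] A) (hcomm : ∀ a : A, α (γ a) = γ (α a))
    (u : A) (hγu : γ u = u) (hu : ∀ a : A, u * a = γ a * u)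
    (p : kˣ) (φ : A →ₐ[k] B) (X Y : B)
    (hX : ∀ a : A, X * φ a = φ (α a) * X)
    (hY : ∀ a : A, Y * φ a = φ (γ (α.symm a)) * Y)
    (hYX : Y * X = (p : k) • (X * Y) + φ u - (p : k) • φ (α u)) :
    ∀ (a : A) (i j : ℕ), 1 ≤ i →
      Y * φ a * X ^ i * Y ^ j =
        ((p : k) ^ i) • (φ (γ (α.symm a)) * X ^ i * Y ^ (j + 1)) -
          φ (γ (α.symm a) * (((p : k) ^ i) • ((α ^ i) u) - u)) * X ^ (i - 1) * Y ^ j := by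
  have hXn : ∀ (n : ℕ) (a : A), X ^ n * φ a = φ ((α ^ n) a) * X ^ n := by
    intro n
    induction n with
    | zero => intro a; simp
    | succ n ih =>
      intro a
      rw [pow_succ X, mul_assoc, hX, ← mul_assoc, ih, mul_assoc, pow_succ α]
      rfl
  have key : ∀ n : ℕ, Y * X ^ (n + 1) = ((p : k) ^ (n + 1)) • (X ^ (n + 1) * Y)
      - ((p : k) ^ (n + 1)) • (φ ((α ^ (n + 1)) u) * X ^ n) + φ u * X ^ n := by
    intro n
    induction n with
    | zero => simp [hYX]; abel
    | succ n ih =>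
      have h1 : X ^ (n + 1) * φ (α u) = φ ((α ^ (n + 1 + 1)) u) * X ^ (n + 1) := by
        rw [hXn, pow_succ α (n + 1)]
        rfl
      rw [pow_succ X (n + 1), ← mul_assoc, ih, add_mul, sub_mul, smul_mul_assoc, smul_mul_assoc,
        mul_assoc (X ^ (n + 1)) Y X, hYX, mul_sub, mul_add, mul_smul_comm, mul_smul_comm, h1, hXn,
        mul_assoc _ (X ^ n) X, mul_assoc _ (X ^ n) X, ← pow_succ X n, smul_sub, smul_add, smul_smul,
        smul_smul, ← pow_succ (p : k), ← mul_assoc]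
      abel
  intro a i j hi
  obtain ⟨n, rfl⟩ : ∃ n, i = n + 1 := ⟨i - 1, by omega⟩
  rw [hY, mul_assoc _ Y, key, Nat.add_sub_cancel, pow_succ' Y j, map_mul, map_sub, map_smul]
  simp only [mul_add, mul_sub, add_mul, sub_mul, smul_mul_assoc, mul_smul_comm, mul_assoc]
  abel
end

section
/- Let z := Y·X − φ(u) ∈ B (the Casimir element). Then z = p·(X·Y − φ(α(u))), z·X = p·X·z, z·Y = p^{−1}·Y·z, and z·φ(a) = φ(γ(a))·z for all a ∈ A. (The identities for the Casimir element used in the proof of Lemma 1.3.) -/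
/-- The identities for the Casimir element `z = YX − φ(u)` of Jordan's iterated
skew polynomial ring `E(A,u,α,p)` (used in the proof of Lemma 1.3 of
Guccione–Guccione): `z = p(XY − φ(α(u)))`, `zX = pXz`, `zY = p⁻¹Yz` and
`zφ(a) = φ(γ(a))z` for all `a ∈ A`. -/
theorem stmt3 {k A B : Type*} [CommRing k] [Ring A] [Algebra k A]
    [Ring B] [Algebra k B]
    (α γ : A ≃ₐ[k] A) (hcomm : ∀ a : A, α (γ a) = γ (α a))
    (u : A) (hγu : γ u = u) (hu : ∀ a : A, u * a = γ a * u)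
    (p : kˣ) (φ : A →ₐ[k] B) (X Y : B)
    (hX : ∀ a : A, X * φ a = φ (α a) * X)
    (hY : ∀ a : A, Y * φ a = φ (γ (α.symm a)) * Y)
    (hYX : Y * X = (p : k) • (X * Y) + φ u - (p : k) • φ (α u)) :
    Y * X - φ u = (p : k) • (X * Y - φ (α u)) ∧
    (Y * X - φ u) * X = (p : k) • (X * (Y * X - φ u)) ∧
    (Y * X - φ u) * Y = ((p⁻¹ : kˣ) : k) • (Y * (Y * X - φ u)) ∧
    ∀ a : A, (Y * X - φ u) * φ a = φ (γ a) * (Y * X - φ u) := by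
  have h1 : Y * X - φ u = (p : k) • (X * Y - φ (α u)) := by
    rw [hYX, smul_sub]; abel
  have hYu : Y * φ (α u) = φ u * Y := by
    rw [hY, AlgEquiv.symm_apply_apply, hγu]
  refine ⟨h1, ?_, ?_, ?_⟩
  · have h2 : (X * Y - φ (α u)) * X = X * (Y * X - φ u) := by
      rw [sub_mul, mul_sub, hX, mul_assoc]
    rw [← h2, ← smul_mul_assoc, ← h1]
  · have h3 : Y * (X * Y - φ (α u)) = (Y * X - φ u) * Y := by
      rw [sub_mul, mul_sub, hYu, mul_assoc]
    have h4 : Y * (Y * X - φ u) = (p : k) • ((Y * X - φ u) * Y) := by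
      rw [← h3, ← mul_smul_comm, ← h1]
    rw [h4, smul_smul, Units.inv_mul, one_smul]
  · intro a
    rw [sub_mul, mul_sub, mul_assoc, hX, ← mul_assoc, hY, AlgEquiv.symm_apply_apply,
      mul_assoc, ← map_mul, hu, map_mul]
end

section
/- For all integers n ≥ 1 and −1 ≤ j ≤ n−1, the polynomial identity T_λ(𝔘_j^n) = −T_{(j+2)λ}(u) · 𝔘_{j+1}^n holds in k[t]; in particular T_λ(𝔘_{n−1}^n) = −T_{(n+1)λ}(u). (The difference identities for 𝔘_j^n used in the proof of Lemma 2.2.3.) -/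
open Polynomial

/-- `T μ P = P(t+μ) − P(t)`, the difference operator of Section 2.2 of
Guccione–Guccione, "Hochschild homology of iterated skew polynomial rings". -/
noncomputable def Tdiff {k : Type*} [Field k] (μ : k) (P : k[X]) : k[X] :=
  P.comp (X + C μ) - P

open scoped Classical in
/-- `𝔘_j^n = (−1)^{n−j} Σ_{0 ≤ i₁ ≤ ⋯ ≤ i_{n−j} ≤ j+1} u(t+i₁λ)⋯u(t+i_{n−j}λ)`,
the sum running over weakly increasing sequences of `n−j` integers between `0`
and `j+1` (so `𝔘_n^n = 1`). -/
noncomputable def Ufrak {k : Type*} [Field k] (u : k[X]) (lam : k) (n : ℕ) (j : ℤ) : k[X] :=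
  (-1) ^ (((n : ℤ) - j).toNat) *
    ∑ f ∈ Finset.univ.filter
        (fun f : Fin (((n : ℤ) - j).toNat) → Fin ((j + 2).toNat) => Monotone f),
      ∏ l, u.comp (X + C (((f l : ℕ) : k) * lam))

open scoped Classical in
/-- Complete homogeneous sum of degree `m` in `a 0, …, a (N-1)`. -/
noncomputable def Hsum {R : Type*} [CommRing R] (a : ℕ → R) (m N : ℕ) : R :=
  ∑ f ∈ Finset.univ.filter (fun f : Fin m → Fin N => Monotone f), ∏ l, a (f l : ℕ)

theorem Hsum_first {R : Type*} [CommRing R] (a : ℕ → R) (m N : ℕ) :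
    Hsum a (m + 1) (N + 1) =
      a 0 * Hsum a m (N + 1) + Hsum (fun i => a (i + 1)) (m + 1) N := by
  classical
  unfold Hsum
  rw [← Finset.sum_filter_add_sum_filter_not _ (fun f => f 0 = 0), Finset.mul_sum]
  congr 1
  · symm
    refine Finset.sum_bij (fun f _ => Fin.cons (α := fun _ => Fin (N + 1)) 0 f) ?_ ?_ ?_ ?_
    · intro f hf
      simp only [Finset.mem_filter, Finset.mem_univ, true_and] at hf ⊢
      refine ⟨?_, by simp⟩
      intro i j hij
      induction i using Fin.cases with
      | zero => simp
      | succ i =>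
        induction j using Fin.cases with
        | zero => simp at hij
        | succ j => simpa using hf (by simpa using hij)
    · intro f _ g _ h
      exact Fin.cons_right_injective (α := fun _ => Fin (N + 1)) 0 h
    · intro f hf
      simp only [Finset.mem_filter, Finset.mem_univ, true_and] at hf
      refine ⟨Fin.tail f, ?_, ?_⟩
      · simp only [Finset.mem_filter, Finset.mem_univ, true_and]
        intro i j hij
        exact hf.1 (by simpa using hij)
      · rw [← hf.2]; exact Fin.cons_self_tail f
    · intro f _
      simp [Fin.prod_univ_succ]
  · symm
    refine Finset.sum_bij (fun f _ => fun i => (f i).succ) ?_ ?_ ?_ ?_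
    · intro f hf
      simp only [Finset.mem_filter, Finset.mem_univ, true_and] at hf ⊢
      exact ⟨fun i j hij => by simpa using hf hij, Fin.succ_ne_zero _⟩
    · intro f _ g _ h
      funext i
      exact Fin.succ_injective _ (congrFun h i)
    · intro f hf
      simp only [Finset.mem_filter, Finset.mem_univ, true_and] at hf
      have h0 : ∀ i, f i ≠ 0 := fun i h => hf.2 (by
        have := hf.1 (Fin.zero_le i)
        rw [h] at this
        exact Fin.le_zero_iff.mp this)
      refine ⟨fun i => (f i).pred (h0 i), ?_, ?_⟩
      · simp only [Finset.mem_filter, Finset.mem_univ, true_and]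
        intro i j hij
        simpa using hf.1 hij
      · funext i; simp
    · intro f _
      simp

theorem Hsum_last {R : Type*} [CommRing R] (a : ℕ → R) (m N : ℕ) :
    Hsum a (m + 1) (N + 1) = a N * Hsum a m (N + 1) + Hsum a (m + 1) N := by
  classical
  unfold Hsum
  rw [← Finset.sum_filter_add_sum_filter_not _ (fun f => f (Fin.last m) = Fin.last N),
    Finset.mul_sum]
  congr 1
  · symm
    refine Finset.sum_bij
      (fun f _ => Fin.snoc (α := fun _ => Fin (N + 1)) f (Fin.last N)) ?_ ?_ ?_ ?_
    · intro f hf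
      simp only [Finset.mem_filter, Finset.mem_univ, true_and] at hf ⊢
      refine ⟨?_, by simp⟩
      intro i j hij
      induction j using Fin.lastCases with
      | last => simp [Fin.le_last]
      | cast j =>
        induction i using Fin.lastCases with
        | last =>
          exact absurd hij (not_le.mpr (Fin.castSucc_lt_last j))
        | cast i => simpa using hf (by simpa using hij)
    · intro f _ g _ h
      exact Fin.snoc_left_injective (α := fun _ => Fin (N + 1)) (Fin.last N) h
    · intro f hf
      simp only [Finset.mem_filter, Finset.mem_univ, true_and] at hf
      refine ⟨Fin.init f, ?_, ?_⟩
      · simp only [Finset.mem_filter, Finset.mem_univ, true_and]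
        intro i j hij
        exact hf.1 (by simpa using hij)
      · rw [← hf.2]; exact Fin.snoc_init_self f
    · intro f _
      simp [Fin.prod_univ_castSucc, mul_comm]
  · symm
    refine Finset.sum_bij (fun f _ => fun i => (f i).castSucc) ?_ ?_ ?_ ?_
    · intro f hf
      simp only [Finset.mem_filter, Finset.mem_univ, true_and] at hf ⊢
      exact ⟨fun i j hij => by simpa using hf hij, (Fin.castSucc_lt_last _).ne⟩
    · intro f _ g _ h
      funext i
      exact Fin.castSucc_injective _ (congrFun h i)
    · intro f hf
      simp only [Finset.mem_filter, Finset.mem_univ, true_and] at hf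
      have h0 : ∀ i, f i ≠ Fin.last N := fun i h => hf.2 (by
        have := hf.1 (Fin.le_last i)
        rw [h] at this
        exact Fin.last_le_iff.mp this)
      refine ⟨fun i => (f i).castPred (h0 i), ?_, ?_⟩
      · simp only [Finset.mem_filter, Finset.mem_univ, true_and]
        intro i j hij
        simpa using hf.1 hij
      · funext i; simp
    · intro f _
      simp

theorem Ufrak_eq {k : Type*} [Field k] (u : k[X]) (lam : k) (n : ℕ) (j : ℤ) (m N : ℕ)
    (hm : ((n : ℤ) - j).toNat = m) (hN : (j + 2).toNat = N) :
    Ufrak u lam n j =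
      (-1) ^ m * Hsum (fun i => u.comp (X + C ((i : k) * lam))) m N := by
  subst hm hN
  rfl

theorem Hsum_comp {k : Type*} [Field k] (u : k[X]) (lam : k) (m N : ℕ) :
    (Hsum (fun i => u.comp (X + C ((i : k) * lam))) m N).comp (X + C lam) =
      Hsum (fun i => u.comp (X + C (((i + 1 : ℕ) : k) * lam))) m N := by
  unfold Hsum
  rw [Polynomial.sum_comp]
  refine Finset.sum_congr rfl fun f _ => ?_
  rw [Polynomial.prod_comp]
  refine Finset.prod_congr rfl fun l _ => ?_
  rw [Polynomial.comp_assoc]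
  congr 1
  simp only [add_comp, X_comp, C_comp, Nat.cast_add, Nat.cast_one, add_mul, one_mul, C_add]
  ring

theorem Hsum_zero {R : Type*} [CommRing R] (a : ℕ → R) (N : ℕ) : Hsum a 0 N = 1 := by
  unfold Hsum
  have h : ∀ f : Fin 0 → Fin N, Monotone f := fun f i => i.elim0
  simp [h]

/-- The difference identity `T_λ(𝔘_j^n) = −T_{(j+2)λ}(u)·𝔘_{j+1}^n` for
`n ≥ 1`, `−1 ≤ j ≤ n−1`; in particular `T_λ(𝔘_{n−1}^n) = −T_{(n+1)λ}(u)`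
(used in the proof of Lemma 2.2.3 of Guccione–Guccione). -/
theorem stmt6 {k : Type*} [Field k] [CharZero k] (lam : k) (hlam : lam ≠ 0)
    (u : k[X]) (n : ℕ) (hn : 1 ≤ n) :
    (∀ j : ℤ, -1 ≤ j → j ≤ (n : ℤ) - 1 →
        Tdiff lam (Ufrak u lam n j) =
          -(Tdiff (((j + 2 : ℤ) : k) * lam) u * Ufrak u lam n (j + 1))) ∧
      Tdiff lam (Ufrak u lam n ((n : ℤ) - 1)) =
        -Tdiff ((((n : ℕ) + 1 : ℕ) : k) * lam) u := by
  have main : ∀ j : ℤ, -1 ≤ j → j ≤ (n : ℤ) - 1 →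
        Tdiff lam (Ufrak u lam n j) =
          -(Tdiff (((j + 2 : ℤ) : k) * lam) u * Ufrak u lam n (j + 1)) := by
    intro j h1 h2
    obtain ⟨m, hm⟩ : ∃ m : ℕ, (n : ℤ) - j = m + 1 := ⟨((n : ℤ) - j - 1).toNat, by omega⟩
    obtain ⟨N, hN⟩ : ∃ N : ℕ, j + 2 = N := ⟨(j + 2).toNat, by omega⟩
    rw [Ufrak_eq u lam n j (m + 1) N (by omega) (by omega),
      Ufrak_eq u lam n (j + 1) m (N + 1) (by omega) (by omega), hN]
    have hA := Hsum_first (fun i => u.comp (X + C ((i : k) * lam))) m N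
    have hB := Hsum_last (fun i => u.comp (X + C ((i : k) * lam))) m N
    simp only [Nat.cast_zero, zero_mul, C_0, add_zero, comp_X] at hA hB
    unfold Tdiff
    rw [mul_comp, Hsum_comp]
    have hs : (((-1) ^ (m + 1) : k[X])).comp (X + C lam) = (-1) ^ (m + 1) := by
      simp
    rw [hs, Int.cast_natCast]
    linear_combination (-1) ^ (m + 1) * (hB - hA)
  refine ⟨main, ?_⟩
  rw [main _ (by omega) le_rfl,
    Ufrak_eq u lam n ((n : ℤ) - 1 + 1) 0 (n + 2) (by omega) (by omega), Hsum_zero]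
  have : (((n : ℤ) - 1 + 2 : ℤ) : k) = ((n + 1 : ℕ) : k) := by push_cast; ring
  rw [this]
  simp
end

section
/- Assume u ∉ k (u is not a constant polynomial). Then the k-linear map δ10 is injective. (Part of Lemma 2.2.4: ker δ_{10} = ⊕_{i≥0} A x^i y^i, δ_{20} is injective, and H_2(W_{*0}(E)) = 0.) -/
open Polynomial

theorem Tdiff_ne_zero {k : Type*} [Field k] [CharZero k] (m : k) (hm : m ≠ 0)
    (u : k[X]) (hu : ∀ c : k, u ≠ C c) : Tdiff m u ≠ 0 := by
  intro h
  have h1 : u.comp (X + C m) = u := sub_eq_zero.mp h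
  have h2 : ∀ x : k, u.eval (x + m) = u.eval x := by
    intro x
    have := congrArg (Polynomial.eval x) h1
    simpa [Polynomial.eval_comp] using this
  have h3 : ∀ n : ℕ, u.eval ((n : k) * m) = u.eval 0 := by
    intro n
    induction n with
    | zero => simp
    | succ n ih => rw [Nat.cast_succ, add_mul, one_mul, h2, ih]
  apply hu (u.eval 0)
  apply Polynomial.eq_of_infinite_eval_eq
  refine (Set.infinite_range_of_injective (f := fun n : ℕ => (n : k) * m) ?_).mono ?_
  · intro a b hab
    exact Nat.cast_injective (mul_right_cancel₀ hm hab)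
  · rintro _ ⟨n, rfl⟩
    simp [h3]

theorem Tdiff_add {k : Type*} [Field k] (m : k) (P Q : k[X]) :
    Tdiff m (P + Q) = Tdiff m P + Tdiff m Q := by
  simp only [Tdiff, Polynomial.add_comp]; ring

theorem Tdiff_zero {k : Type*} [Field k] (m : k) : Tdiff m (0 : k[X]) = 0 := by
  simp [Tdiff]

/-- Part of Lemma 2.2.4 of Guccione–Guccione: if `u ∉ k`, the boundary map
`δ₁₀` of `W_{**}(E)` (on the summand `⊕_{j≥0} k[t]·x^j y^{j+1} e₁`, modelled
as `ℕ →₀ k[t]`) is injective. -/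
theorem stmt9 {k : Type*} [Field k] [CharZero k] (lam : k) (hlam : lam ≠ 0)
    (u : k[X]) (hu : ∀ c : k, u ≠ C c)
    (D : (ℕ →₀ k[X]) →ₗ[k] (ℕ →₀ k[X]))
    (hD : ∀ (j : ℕ) (Q : k[X]),
      D (Finsupp.single j Q) =
        -Finsupp.single (j + 1) (Tdiff lam Q) -
          Finsupp.single j (Q * Tdiff (((j : k) + 1) * lam) u)) :
    Function.Injective D := by
  have hne : ∀ j : ℕ, Tdiff (((j : k) + 1) * lam) u ≠ 0 := fun j =>
    Tdiff_ne_zero _ (mul_ne_zero (Nat.cast_add_one_ne_zero j) hlam) u hu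
  have h0 : ∀ f : ℕ →₀ k[X], D f 0 = -(f 0 * Tdiff ((((0 : ℕ) : k) + 1) * lam) u) := by
    intro f
    induction f using Finsupp.induction_linear with
    | zero => simp
    | add f g hf hg => rw [map_add, Finsupp.add_apply, hf, hg, Finsupp.add_apply]; ring
    | single j Q =>
      rw [hD]
      by_cases hj : j = 0
      · subst hj; simp
      · simp [Finsupp.single_apply, hj]
  have h1 : ∀ (f : ℕ →₀ k[X]) (i : ℕ), D f (i + 1) =
      -Tdiff lam (f i) - f (i + 1) * Tdiff ((((i + 1 : ℕ) : k) + 1) * lam) u := by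
    intro f i
    induction f using Finsupp.induction_linear with
    | zero => simp [Tdiff_zero]
    | add f g hf hg =>
      rw [map_add D, Finsupp.add_apply, hf, hg, Finsupp.add_apply, Finsupp.add_apply, Tdiff_add]
      ring
    | single j Q =>
      rw [hD]
      by_cases hj : j = i
      · subst hj; simp
      · by_cases hj' : j = i + 1
        · subst hj'; simp [Tdiff_zero]
        · simp [Finsupp.single_apply, hj, hj', Tdiff_zero]
  rw [injective_iff_map_eq_zero]
  intro f hf
  ext1 i
  induction i with
  | zero =>
    have := h0 f
    rw [hf] at this
    simpa only [Finsupp.coe_zero, Pi.zero_apply, zero_eq_neg, mul_eq_zero, hne, or_false] using this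
  | succ i ih =>
    have := h1 f i
    rw [hf, ih] at this
    simpa only [Finsupp.coe_zero, Pi.zero_apply, Tdiff_zero, neg_zero, zero_sub, zero_eq_neg,
      mul_eq_zero, hne, or_false] using this
end

section
/- Assume u ∉ k (u is not a constant polynomial). Then the k-linear map δ11 is surjective. (Part of Lemma 2.2.6: H_0(W_{*1}(E)) = 0.) -/
open Polynomial

theorem Tdiff_surj_aux {k : Type*} [Field k] [CharZero k] (lam : k) (hlam : lam ≠ 0) (n : ℕ) :
    ∀ P : k[X], (∀ m, n ≤ m → P.coeff m = 0) → ∃ Q, Tdiff lam Q = P := by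
  induction n with
  | zero =>
    intro P hP
    refine ⟨0, ?_⟩
    ext m
    simp [Tdiff, hP m (Nat.zero_le m)]
  | succ n ih =>
    intro P hP
    have hn : ((n : k) + 1) ≠ 0 := Nat.cast_add_one_ne_zero n
    set c : k := P.coeff n / (((n : k) + 1) * lam) with hc
    obtain ⟨Q, hQ⟩ := ih (P - Tdiff lam (C c * X ^ (n + 1))) (by
      intro m hm
      have e : Tdiff lam (C c * X ^ (n + 1)) = C c * ((X + C lam) ^ (n + 1) - X ^ (n + 1)) := by
        simp [Tdiff, mul_sub]
      rw [e, coeff_sub, coeff_C_mul, coeff_sub, coeff_X_add_C_pow, coeff_X_pow]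
      rcases Nat.lt_or_ge n m with h | h
      · rw [hP m h]
        rcases Nat.lt_or_ge (n + 1) m with h' | h'
        · rw [Nat.choose_eq_zero_of_lt h']
          simp [show m ≠ n + 1 by omega]
        · have : m = n + 1 := by omega
          subst this
          simp
      · have : m = n := by omega
        subst this
        simp [hc]
        field_simp
        simp)
    refine ⟨Q + C c * X ^ (n + 1), ?_⟩
    have : Tdiff lam (Q + C c * X ^ (n + 1)) = Tdiff lam Q + Tdiff lam (C c * X ^ (n + 1)) := by
      simp only [Tdiff, add_comp]
      ring
    rw [this, hQ]
    ring

theorem Tdiff_surj {k : Type*} [Field k] [CharZero k] (lam : k) (hlam : lam ≠ 0) (P : k[X]) :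
    ∃ Q, Tdiff lam Q = P :=
  Tdiff_surj_aux lam hlam (P.natDegree + 1) P
    (fun _ hm => coeff_eq_zero_of_natDegree_lt (by omega))

/-- Part of Lemma 2.2.6 of Guccione–Guccione (`H₀(W_{*1}(E)) = 0`): if `u ∉ k`,
the boundary map `δ₁₁` of `W_{**}(E)` (on the summand `⊕_{j≥0} k[t]·x^j y^j e₁e₂`,
modelled as `ℕ →₀ k[t]`) is surjective. -/
theorem stmt13 {k : Type*} [Field k] [CharZero k] (lam : k) (hlam : lam ≠ 0)
    (u : k[X]) (hu : ∀ c : k, u ≠ C c)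
    (D : (ℕ →₀ k[X]) →ₗ[k] (ℕ →₀ k[X]))
    (hD0 : ∀ Q : k[X], D (Finsupp.single 0 Q) = -Finsupp.single 0 (Tdiff lam Q))
    (hD : ∀ (j : ℕ) (Q : k[X]),
      D (Finsupp.single (j + 1) Q) =
        -Finsupp.single (j + 1) (Tdiff lam Q) -
          Finsupp.single j (Q * (Tdiff (((j : k) + 1) * lam) u).comp (X + C lam))) :
    Function.Surjective D := by
  have key : ∀ (i : ℕ) (P : k[X]), Finsupp.single i P ∈ LinearMap.range D := by
    intro i
    induction i with
    | zero =>
      intro P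
      obtain ⟨Q, rfl⟩ := Tdiff_surj lam hlam P
      exact ⟨-Finsupp.single 0 Q, by rw [map_neg, hD0, neg_neg]⟩
    | succ j ih =>
      intro P
      obtain ⟨Q, rfl⟩ := Tdiff_surj lam hlam P
      obtain ⟨R, hR⟩ := ih (Q * (Tdiff (((j : k) + 1) * lam) u).comp (X + C lam))
      refine ⟨-Finsupp.single (j + 1) Q - R, ?_⟩
      rw [map_sub, map_neg, hD, hR]
      abel
  intro f
  change f ∈ LinearMap.range D
  induction f using Finsupp.induction_linear with
  | zero => exact Submodule.zero_mem _
  | add f g hf hg => exact Submodule.add_mem _ hf hg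
  | single i P => exact key i P
end
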